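/- Let n, w, d, k be positive integers with k < w, 2w ≤ n, and 2k < n. Define a_i = [n(w−i)(n−w−i)/(w(n−w)(n−2i))]·√((i+1)(n−i+1)/((n−2i+1)(n−2i−1))) for i = 0,…,k−1 and b_i = (n−2w)²·i·(n−i+1)/(w(n−w)(n−2i)(n−2i+2)) for i = 0,…,k. Let S_k be the (k+1)×(k+1) symmetric tridiagonal matrix with diagonal entries b_0,…,b_k and off-diagonal entries a_0,…,a_{k−1}. If λmax(S_{k−1}) ≥ 1 − n·d/(w(n−w)) and λmax(S_k) < 1, then every constant-weight code C ⊆ J^{n,w} with minimum Hamming distance at least 2d satisfies |C| ≤ 4n(w−k)(n−w−k)·C(n,k) / ((1 − λmax(S_k))·w(n−w)(n−2k)). -/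

import Mathlib

/-- Symmetric tridiagonal (k+1)×(k+1) matrix with diagonal `d 0, …, d k` and
off-diagonal `o 0, …, o (k-1)`. -/
noncomputable def Tridiag (k : ℕ) (d o : ℕ → ℝ) : Matrix (Fin (k + 1)) (Fin (k + 1)) ℝ :=
  Matrix.of fun i j =>
    if (i : ℕ) = (j : ℕ) then d i
    else if (i : ℕ) + 1 = (j : ℕ) then o i
    else if (j : ℕ) + 1 = (i : ℕ) then o j
    else 0

/-- The largest eigenvalue of a real square matrix. -/
noncomputable def maxEig {m : ℕ} (M : Matrix (Fin m) (Fin m) ℝ) : ℝ :=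
  sSup {μ : ℝ | Module.End.HasEigenvalue (Matrix.toLin' M) μ}

/-- The Hamming weight of a binary vector. -/
def wt {n : ℕ} (x : Fin n → Bool) : ℕ := (Finset.univ.filter fun i => x i = true).card

/-- The product `∏_{r < j} (x - r) (y - r) / j!`. -/
noncomputable def fallProd (x y : ℝ) (j : ℕ) : ℝ :=
  (∏ r ∈ Finset.range j, (x - r) * (y - r)) / (j.factorial : ℝ)

lemma fallProd_succ (x y : ℝ) (j : ℕ) :
    ((j : ℝ) + 1) * fallProd x y (j + 1) = (x - j) * (y - j) * fallProd x y j := by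
  have h : (j.factorial : ℝ) ≠ 0 := by positivity
  have h1 : (j : ℝ) + 1 ≠ 0 := by positivity
  simp only [fallProd, Finset.prod_range_succ, Nat.factorial_succ]
  push_cast
  field_simp

lemma fallProd_succ' (x y : ℝ) (j : ℕ) :
    ((j : ℝ) + 1) * fallProd x y (j + 1) = x * y * fallProd (x - 1) (y - 1) j := by
  have h : (j.factorial : ℝ) ≠ 0 := by positivity
  have h1 : (j : ℝ) + 1 ≠ 0 := by positivity
  have h2 : ∀ r : ℕ, (x - ((r + 1 : ℕ) : ℝ)) * (y - ((r + 1 : ℕ) : ℝ))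
      = (x - 1 - r) * (y - 1 - r) := by
    intro r; push_cast; ring
  simp only [fallProd, Finset.prod_range_succ', Nat.factorial_succ, h2]
  push_cast
  field_simp
  ring

lemma fallProd_pos {x y : ℝ} {j : ℕ} (hx : (j : ℝ) ≤ x) (hy : (j : ℝ) ≤ y) :
    0 < fallProd x y j := by
  unfold fallProd
  refine div_pos (Finset.prod_pos fun r hr => ?_) (by positivity)
  have : (r : ℝ) < j := by exact_mod_cast Finset.mem_range.1 hr
  exact mul_pos (by linarith) (by linarith)

section
open Finset

/-- The (unnormalized) Hahn polynomial of degree `i`, as a function of the four cell counts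
of the contingency table of a pair of binary vectors. -/
noncomputable def hahn (i : ℕ) (A B C D : ℝ) : ℝ :=
  ∑ p ∈ antidiagonal i, (-1) ^ p.1 * fallProd B C p.1 * fallProd A D p.2

lemma sum_antidiagonal_fst_mul (G : ℕ → ℕ → ℝ) (m : ℕ) (A B C D : ℝ) :
    ∑ p ∈ antidiagonal (m + 1),
      (p.1 : ℝ) * G p.1 p.2 * ((-1) ^ p.1 * fallProd B C p.1 * fallProd A D p.2)
    = ∑ p ∈ antidiagonal m, -((B - p.1) * (C - p.1)) * G (p.1 + 1) p.2 *
      ((-1) ^ p.1 * fallProd B C p.1 * fallProd A D p.2) := by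
  rw [Finset.Nat.sum_antidiagonal_succ]
  simp only [Nat.cast_zero, zero_mul, zero_add]
  refine Finset.sum_congr rfl fun p _ => ?_
  have := fallProd_succ B C p.1
  push_cast
  linear_combination (G (p.1 + 1) p.2 * (-1) ^ (p.1 + 1) * fallProd A D p.2) * this

lemma sum_antidiagonal_snd_mul (G : ℕ → ℕ → ℝ) (m : ℕ) (A B C D : ℝ) :
    ∑ p ∈ antidiagonal (m + 1),
      (p.2 : ℝ) * G p.1 p.2 * ((-1) ^ p.1 * fallProd B C p.1 * fallProd A D p.2)
    = ∑ p ∈ antidiagonal m, ((A - p.2) * (D - p.2)) * G p.1 (p.2 + 1) *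
      ((-1) ^ p.1 * fallProd B C p.1 * fallProd A D p.2) := by
  rw [Finset.Nat.sum_antidiagonal_succ']
  simp only [Nat.cast_zero, zero_mul, zero_add]
  refine Finset.sum_congr rfl fun p _ => ?_
  have := fallProd_succ A D p.2
  push_cast
  linear_combination (G p.1 (p.2 + 1) * (-1) ^ p.1 * fallProd B C p.1) * this

lemma succ_mul_hahn_succ (i : ℕ) (A B C D : ℝ) :
    ((i : ℝ) + 1) * hahn (i + 1) A B C D = ∑ p ∈ antidiagonal i,
      (-((B - p.1) * (C - p.1)) + (A - p.2) * (D - p.2)) *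
      ((-1) ^ p.1 * fallProd B C p.1 * fallProd A D p.2) := by
  have h1 := sum_antidiagonal_fst_mul (fun _ _ => 1) i A B C D
  have h2 := sum_antidiagonal_snd_mul (fun _ _ => 1) i A B C D
  simp only [mul_one] at h1 h2
  refine Eq.trans ?_ (Eq.trans (congrArg₂ (· + ·) h1 h2) ?_)
  · rw [← Finset.sum_add_distrib, hahn, Finset.mul_sum]
    refine Finset.sum_congr rfl fun p hp => ?_
    have : (p.1 : ℝ) + p.2 = i + 1 := by exact_mod_cast mem_antidiagonal.1 hp
    rw [← this]; ring
  · rw [← Finset.sum_add_distrib]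
    exact Finset.sum_congr rfl fun p _ => by ring

lemma succ_mul_hahn_succ' (i : ℕ) (A B C D : ℝ) :
    ((i : ℝ) + 1) * hahn (i + 1) A B C D
      = A * D * hahn i (A - 1) B C (D - 1) - B * C * hahn i A (B - 1) (C - 1) D := by
  have h : ((i : ℝ) + 1) * hahn (i + 1) A B C D
      = ∑ p ∈ antidiagonal (i + 1),
          (p.2 : ℝ) * ((-1) ^ p.1 * fallProd B C p.1 * fallProd A D p.2)
        + ∑ p ∈ antidiagonal (i + 1),
          (p.1 : ℝ) * ((-1) ^ p.1 * fallProd B C p.1 * fallProd A D p.2) := by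
    rw [← Finset.sum_add_distrib, hahn, Finset.mul_sum]
    refine Finset.sum_congr rfl fun p hp => ?_
    have : (p.1 : ℝ) + p.2 = i + 1 := by exact_mod_cast mem_antidiagonal.1 hp
    rw [← this]; ring
  rw [h, Finset.Nat.sum_antidiagonal_succ', Finset.Nat.sum_antidiagonal_succ]
  simp only [Nat.cast_zero, zero_mul, zero_add, hahn, Finset.mul_sum, ← Finset.sum_add_distrib,
    ← Finset.sum_sub_distrib]
  refine Finset.sum_congr rfl fun p _ => ?_
  have h1 := fallProd_succ' A D p.2
  have h2 := fallProd_succ' B C p.1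
  push_cast
  linear_combination (-1) ^ p.1 * fallProd B C p.1 * h1
    + (-1) ^ (p.1 + 1) * fallProd A D p.2 * h2

lemma hahn_zero (A B C D : ℝ) : hahn 0 A B C D = 1 := by
  simp [hahn, fallProd]

lemma fallProd_zero_succ (j : ℕ) : fallProd 0 0 (j + 1) = 0 := by
  simp [fallProd, Finset.prod_range_succ']

lemma hahn_diag (i : ℕ) (A D : ℝ) : hahn i A 0 0 D = fallProd A D i := by
  cases i with
  | zero => simp [hahn, fallProd]
  | succ i =>
    rw [hahn, Finset.Nat.sum_antidiagonal_succ]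
    simp [fallProd_zero_succ]
    simp [fallProd]

/-- Three-term recurrence of the Hahn polynomials. -/
lemma hahn_recurrence (m : ℕ) (n w t : ℝ) (h0 : n - 2 * (m + 1) ≠ 0)
    (h1 : n - 2 * (m + 1) + 1 ≠ 0) (h2 : n - 2 * (m + 1) + 2 ≠ 0) :
    (w * (n - w) - n * t) * hahn (m + 1) (w - t) t t (n - w - t)
      = n * (n - m) / ((n - 2 * (m + 1)) * (n - 2 * (m + 1) + 1))
          * ((m + 2) * hahn (m + 2) (w - t) t t (n - w - t))
        + (n - 2 * w) ^ 2 * (m + 1) * (n - m)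
            / ((n - 2 * (m + 1)) * (n - 2 * (m + 1) + 2))
          * hahn (m + 1) (w - t) t t (n - w - t)
        + n * (w - m) ^ 2 * (n - w - m) ^ 2
            / ((n - 2 * (m + 1) + 2) * (n - 2 * (m + 1) + 1))
          * hahn m (w - t) t t (n - w - t) := by
  set e : ℝ := -(3 * n - 4 * (m + 1) + 2) / ((n - 2 * (m + 1)) * (n - 2 * (m + 1) + 1))
      * (w * (n - w) - n * t)
      - (n - 2 * w) ^ 2 * (n - m) / ((n - 2 * (m + 1)) * (n - 2 * (m + 1) + 2)) with he
  set α : ℝ := n * (n - m) / ((n - 2 * (m + 1)) * (n - 2 * (m + 1) + 1)) with hα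
  set h : ℝ := n / (n - 2 * (m + 1) + 1) with hh
  have H := succ_mul_hahn_succ (m + 1) (w - t) t t (n - w - t)
  have H1 := sum_antidiagonal_fst_mul (fun _ l => e - α * (2 * t - (m + 1)) + l * h) m
    (w - t) t t (n - w - t)
  have H2 := sum_antidiagonal_snd_mul (fun j _ => e - α * (m + 1 - n + 2 * t) - j * h) m
    (w - t) t t (n - w - t)
  have H3 : ((m : ℝ) + 2) * hahn (m + 2) (w - t) t t (n - w - t) = ∑ p ∈ antidiagonal (m + 1),
      (-((t - p.1) * (t - p.1)) + (w - t - p.2) * (n - w - t - p.2)) *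
      ((-1) ^ p.1 * fallProd t t p.1 * fallProd (w - t) (n - w - t) p.2) := by
    rw [← H]; push_cast; ring
  have H4 : ∑ p ∈ antidiagonal m, (n * (w - m) ^ 2 * (n - w - m) ^ 2
            / ((n - 2 * (m + 1) + 2) * (n - 2 * (m + 1) + 1))) *
      ((-1) ^ p.1 * fallProd t t p.1 * fallProd (w - t) (n - w - t) p.2)
      = ∑ p ∈ antidiagonal (m + 1), ((w * (n - w) - n * t)
        - (n - 2 * w) ^ 2 * (m + 1) * (n - m) / ((n - 2 * (m + 1)) * (n - 2 * (m + 1) + 2))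
        - α * (-((t - p.1) * (t - p.1)) + (w - t - p.2) * (n - w - t - p.2))) *
      ((-1) ^ p.1 * fallProd t t p.1 * fallProd (w - t) (n - w - t) p.2) := by
    refine Eq.trans (Eq.trans ?_ (congrArg₂ (· + ·) H1 H2).symm) ?_
    · rw [← Finset.sum_add_distrib]
      refine Finset.sum_congr rfl fun p hp => ?_
      have : (m : ℝ) = p.1 + p.2 := by exact_mod_cast (mem_antidiagonal.1 hp).symm
      rw [← add_mul]
      congr 1
      have hj : (p.2 : ℝ) = m - p.1 := by linarith
      rw [hj, he, hα, hh]
      field_simp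
      ring
    · rw [← Finset.sum_add_distrib]
      refine Finset.sum_congr rfl fun p hp => ?_
      have : (p.1 : ℝ) + p.2 = m + 1 := by exact_mod_cast (mem_antidiagonal.1 hp)
      rw [← add_mul]
      congr 1
      have hj : (p.2 : ℝ) = m + 1 - p.1 := by linarith
      rw [hj, he, hα, hh]
      generalize hD : n - 2 * ((m : ℝ) + 1) = D at h0 h1 h2 ⊢
      field_simp
      rw [← hD]
      ring
  rw [H3, hahn, hahn, Finset.mul_sum, Finset.mul_sum, Finset.mul_sum, Finset.mul_sum, H4,
    ← Finset.sum_add_distrib, ← Finset.sum_add_distrib]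
  refine Finset.sum_congr rfl fun p hp => ?_
  ring

end

section
open Finset

/-- The `0/1` indicator of a Boolean. -/
noncomputable def bitVal (b : Bool) : ℝ := if b then 1 else 0

/-- The sum over sequences of `i` disjoint ordered pairs `(a_r, b_r)` of coordinates in `U`
of `∏_r (x_{a_r} - x_{b_r}) (y_{a_r} - y_{b_r})`. -/
noncomputable def pairKernel {n : ℕ} : ℕ → Finset (Fin n) → Matrix (Fin n → Bool) (Fin n → Bool) ℝ
  | 0, _ => Matrix.of fun _ _ => 1
  | i + 1, U => Matrix.of fun x y => ∑ a ∈ U, ∑ b ∈ U,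
      (bitVal (x a) - bitVal (x b)) * (bitVal (y a) - bitVal (y b))
        * pairKernel i ((U.erase a).erase b) x y

variable {n : ℕ}

lemma pairKernel_zero (U : Finset (Fin n)) (x y : Fin n → Bool) : pairKernel 0 U x y = 1 := rfl

lemma pairKernel_succ (i : ℕ) (U : Finset (Fin n)) (x y : Fin n → Bool) :
    pairKernel (i + 1) U x y = ∑ a ∈ U, ∑ b ∈ U,
      (bitVal (x a) - bitVal (x b)) * (bitVal (y a) - bitVal (y b))
        * pairKernel i ((U.erase a).erase b) x y := rfl

lemma posSemidef_vecMulVec_self {ι : Type*} [Finite ι] (v : ι → ℝ) :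
    (Matrix.vecMulVec v v).PosSemidef := by
  simpa using Matrix.posSemidef_vecMulVec_self_star v

lemma pairKernel_posSemidef (i : ℕ) (U : Finset (Fin n)) : (pairKernel i U).PosSemidef := by
  induction i generalizing U with
  | zero =>
    convert posSemidef_vecMulVec_self (fun _ : Fin n → Bool => (1 : ℝ)) using 1
    ext x y
    simp [pairKernel_zero, Matrix.vecMulVec_apply]
  | succ i ih =>
    have h : pairKernel (i + 1) U = ∑ a ∈ U, ∑ b ∈ U, Matrix.hadamard
        (Matrix.vecMulVec (fun x : Fin n → Bool => bitVal (x a) - bitVal (x b))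
          (fun x : Fin n → Bool => bitVal (x a) - bitVal (x b)))
        (pairKernel i ((U.erase a).erase b)) := by
      ext x y
      simp [pairKernel_succ, Matrix.sum_apply, Matrix.vecMulVec_apply]
    rw [h]
    exact Matrix.posSemidef_sum _ fun a _ => Matrix.posSemidef_sum _ fun b _ =>
      (posSemidef_vecMulVec_self _).hadamard (ih _)

/-- The sum of `p (x c) * q (y c)` over the coordinates `c ∈ U`. -/
noncomputable def cellSum (p q : Bool → ℝ) (U : Finset (Fin n)) (x y : Fin n → Bool) : ℝ :=
  ∑ c ∈ U, p (x c) * q (y c)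

lemma cellSum_erase (p q : Bool → ℝ) {U : Finset (Fin n)} {a : Fin n} (ha : a ∈ U)
    (x y : Fin n → Bool) :
    cellSum p q (U.erase a) x y = cellSum p q U x y - p (x a) * q (y a) :=
  Finset.sum_erase_eq_sub ha

lemma pairKernel_eq_hahn (i : ℕ) (U : Finset (Fin n)) (x y : Fin n → Bool) :
    pairKernel i U x y = 2 ^ i * (i.factorial : ℝ) * hahn i
      (cellSum bitVal bitVal U x y) (cellSum bitVal (fun b => 1 - bitVal b) U x y)
      (cellSum (fun b => 1 - bitVal b) bitVal U x y)
      (cellSum (fun b => 1 - bitVal b) (fun b => 1 - bitVal b) U x y) := by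
  induction i generalizing U with
  | zero => simp [pairKernel_zero, hahn_zero]
  | succ i ih =>
    set A := cellSum bitVal bitVal U x y with hA
    set B := cellSum bitVal (fun b => 1 - bitVal b) U x y with hB
    set C := cellSum (fun b => 1 - bitVal b) bitVal U x y with hC
    set D := cellSum (fun b => 1 - bitVal b) (fun b => 1 - bitVal b) U x y with hD
    have key : ∀ a ∈ U, ∀ b ∈ U,
        (bitVal (x a) - bitVal (x b)) * (bitVal (y a) - bitVal (y b))
          * pairKernel i ((U.erase a).erase b) x y
        = 2 ^ i * (i.factorial : ℝ) *
          (hahn i (A - 1) B C (D - 1) *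
            ((bitVal (x a) * bitVal (y a)) * ((1 - bitVal (x b)) * (1 - bitVal (y b)))
              + ((1 - bitVal (x a)) * (1 - bitVal (y a))) * (bitVal (x b) * bitVal (y b)))
          - hahn i A (B - 1) (C - 1) D *
            ((bitVal (x a) * (1 - bitVal (y a))) * ((1 - bitVal (x b)) * bitVal (y b))
              + ((1 - bitVal (x a)) * bitVal (y a)) * (bitVal (x b) * (1 - bitVal (y b))))) := by
      intro a ha b hb
      by_cases hab : b = a
      · subst hab
        cases x b <;> cases y b <;> simp [bitVal]
      have hb' : b ∈ U.erase a := Finset.mem_erase.2 ⟨hab, hb⟩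
      rw [ih, cellSum_erase _ _ hb', cellSum_erase _ _ hb', cellSum_erase _ _ hb',
        cellSum_erase _ _ hb', cellSum_erase _ _ ha, cellSum_erase _ _ ha,
        cellSum_erase _ _ ha, cellSum_erase _ _ ha, ← hA, ← hB, ← hC, ← hD]
      cases x a <;> cases y a <;> cases x b <;> cases y b <;> simp [bitVal]
    rw [pairKernel_succ, Finset.sum_congr rfl fun a ha => Finset.sum_congr rfl (key a ha)]
    have h := succ_mul_hahn_succ' i A B C D
    have e : ∀ p q p' q' : Bool → ℝ,
        ∑ a ∈ U, ∑ b ∈ U, (p (x a) * q (y a)) * (p' (x b) * q' (y b))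
          = cellSum p q U x y * cellSum p' q' U x y := fun p q p' q' => by
      rw [cellSum, cellSum, Finset.sum_mul_sum]
    have e1 := e bitVal bitVal (fun b => 1 - bitVal b) (fun b => 1 - bitVal b)
    have e2 := e (fun b => 1 - bitVal b) (fun b => 1 - bitVal b) bitVal bitVal
    have e3 := e bitVal (fun b => 1 - bitVal b) (fun b => 1 - bitVal b) bitVal
    have e4 := e (fun b => 1 - bitVal b) bitVal bitVal (fun b => 1 - bitVal b)
    simp only [← Finset.mul_sum, Finset.sum_sub_distrib, Finset.sum_add_distrib] at e1 e2 e3 e4 ⊢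
    rw [e1, e2, e3, e4, ← hA, ← hB, ← hC, ← hD, Nat.factorial_succ]
    push_cast
    linear_combination (-(2 ^ (i + 1) * (i.factorial : ℝ))) * h

lemma pairKernel_congr_right (i : ℕ) (U : Finset (Fin n)) (x : Fin n → Bool)
    {y z : Fin n → Bool} (h : ∀ c ∈ U, y c = z c) : pairKernel i U x y = pairKernel i U x z := by
  induction i generalizing U with
  | zero => rfl
  | succ i ih =>
    rw [pairKernel_succ, pairKernel_succ]
    refine Finset.sum_congr rfl fun a ha => Finset.sum_congr rfl fun b hb => ?_
    rw [h a ha, h b hb, ih _ fun c hc => h c (Finset.mem_of_mem_erase (Finset.mem_of_mem_erase hc))]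

/-- `pairKernel i U x` is orthogonal to the functions that depend symmetrically on all
but fewer than `i` of the coordinates in `U`. -/
lemma sum_pairKernel_mul_eq_zero (i : ℕ) (U S : Finset (Fin n)) (x : Fin n → Bool)
    (H : (Fin n → Bool) → ℝ)
    (hH : ∀ a ∉ S, ∀ b ∉ S, ∀ y : Fin n → Bool, H (y ∘ Equiv.swap a b) = H y)
    (hS : (S ∩ U).card < i) : ∑ y, pairKernel i U x y * H y = 0 := by
  induction i generalizing U S H with
  | zero => omega
  | succ i ih =>
    simp only [pairKernel_succ, Finset.sum_mul]
    rw [Finset.sum_comm]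
    refine Finset.sum_eq_zero fun a ha => ?_
    rw [Finset.sum_comm]
    refine Finset.sum_eq_zero fun b hb => ?_
    have e : ∀ y : Fin n → Bool, (bitVal (x a) - bitVal (x b)) * (bitVal (y a) - bitVal (y b))
        * pairKernel i ((U.erase a).erase b) x y * H y
        = (bitVal (x a) - bitVal (x b)) * (pairKernel i ((U.erase a).erase b) x y
          * ((bitVal (y a) - bitVal (y b)) * H y)) := fun y => by ring
    simp only [e, ← Finset.mul_sum]
    refine mul_eq_zero_of_right _ ?_
    by_cases hab : a ∉ S ∧ b ∉ S
    · have hs : ∑ y, pairKernel i ((U.erase a).erase b) x y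
            * ((bitVal (y a) - bitVal (y b)) * H y)
          = ∑ y, -(pairKernel i ((U.erase a).erase b) x y
            * ((bitVal (y a) - bitVal (y b)) * H y)) := by
        refine Fintype.sum_equiv ((Equiv.swap a b).arrowCongr (Equiv.refl Bool)) _ _ fun y => ?_
        have h1 : ((Equiv.swap a b).arrowCongr (Equiv.refl Bool)) y = y ∘ Equiv.swap a b := by
          ext c; simp [Equiv.arrowCongr]
        rw [h1, hH a hab.1 b hab.2, pairKernel_congr_right i _ x (y := y ∘ Equiv.swap a b) (z := y)]
        · simp only [Function.comp, Equiv.swap_apply_left, Equiv.swap_apply_right]; ring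
        · intro c hc
          simp only [Finset.mem_erase] at hc
          simp [Function.comp, Equiv.swap_apply_of_ne_of_ne hc.2.1 hc.1]
      rw [Finset.sum_neg_distrib] at hs
      linarith
    · refine ih _ (insert a (insert b S)) _ ?_ ?_
      · intro c hc d hd y
        simp only [Finset.mem_insert, not_or] at hc hd
        simp only [Function.comp]
        rw [Equiv.swap_apply_of_ne_of_ne (Ne.symm hc.1) (Ne.symm hd.1),
          Equiv.swap_apply_of_ne_of_ne (Ne.symm hc.2.1) (Ne.symm hd.2.1)]
        congr 1
        exact hH c hc.2.2 d hd.2.2 y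
      · have hss : insert a (insert b S) ∩ ((U.erase a).erase b) ⊂ S ∩ U := by
          refine Finset.ssubset_iff_subset_ne.2 ⟨?_, ?_⟩
          · intro c hc; simp at hc ⊢; tauto
          · intro h
            rw [Finset.ext_iff] at h
            have h1 := h a
            have h2 := h b
            simp [ha, hb] at h1 h2
            tauto
        have := Finset.card_lt_card hss
        omega

lemma sum_pairKernel_mul_pairKernel_mul_eq_zero (i j : ℕ) (U V S : Finset (Fin n))
    (x x' : Fin n → Bool) (H : (Fin n → Bool) → ℝ)
    (hH : ∀ a ∉ S, ∀ b ∉ S, ∀ y : Fin n → Bool, H (y ∘ Equiv.swap a b) = H y)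
    (hS : (S ∩ U).card + j < i) : ∑ y, pairKernel i U x y * (pairKernel j V x' y * H y) = 0 := by
  induction j generalizing V S H with
  | zero =>
    simp only [pairKernel_zero, one_mul]
    exact sum_pairKernel_mul_eq_zero i U S x H hH hS
  | succ j ih =>
    have single : ∀ (a : Fin n) (W : Finset (Fin n)),
        ∑ y, pairKernel i U x y * (pairKernel j W x' y * (bitVal (y a) * H y)) = 0 := by
      intro a W
      refine ih W (insert a S) _ ?_ ?_
      · intro c hc d hd y
        simp only [Finset.mem_insert, not_or] at hc hd
        simp only [Function.comp]
        rw [Equiv.swap_apply_of_ne_of_ne (Ne.symm hc.1) (Ne.symm hd.1)]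
        congr 1
        exact hH c hc.2 d hd.2 y
      · have h1 : insert a S ∩ U ⊆ insert a (S ∩ U) := by
          intro c hc; simp at hc ⊢; tauto
        have := Finset.card_le_card h1
        have := Finset.card_insert_le a (S ∩ U)
        omega
    simp only [pairKernel_succ j, Finset.sum_mul, Finset.mul_sum]
    rw [Finset.sum_comm]
    refine Finset.sum_eq_zero fun a _ => ?_
    rw [Finset.sum_comm]
    refine Finset.sum_eq_zero fun b _ => ?_
    have h1 := single a ((V.erase a).erase b)
    have h2 := single b ((V.erase a).erase b)
    calc _ = ∑ y, ((bitVal (x' a) - bitVal (x' b)) * (pairKernel i U x y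
              * (pairKernel j ((V.erase a).erase b) x' y * (bitVal (y a) * H y)))
            - (bitVal (x' a) - bitVal (x' b)) * (pairKernel i U x y
              * (pairKernel j ((V.erase a).erase b) x' y * (bitVal (y b) * H y)))) :=
          Finset.sum_congr rfl fun y _ => by ring
      _ = 0 := by
          rw [Finset.sum_sub_distrib, ← Finset.mul_sum, ← Finset.mul_sum, h1, h2]; ring

end

section
open Matrix

lemma finite_setOf_hasEigenvalue {m : ℕ} (M : Matrix (Fin m) (Fin m) ℝ) :
    {μ : ℝ | Module.End.HasEigenvalue (Matrix.toLin' M) μ}.Finite :=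
  Module.End.finite_hasEigenvalue _

lemma le_maxEig {m : ℕ} (M : Matrix (Fin m) (Fin m) ℝ) {μ : ℝ} {v : Fin m → ℝ} (hv : v ≠ 0)
    (h : M *ᵥ v = μ • v) : μ ≤ maxEig M :=
  le_csSup (finite_setOf_hasEigenvalue M).bddAbove
    (Module.End.hasEigenvalue_of_hasEigenvector
      ⟨Module.End.mem_eigenspace_iff.2 (by simpa using h), hv⟩)

lemma exists_mulVec_eq_maxEig_smul {m : ℕ} {M : Matrix (Fin (m + 1)) (Fin (m + 1)) ℝ}
    (hM : M.IsHermitian) : ∃ v ≠ 0, M *ᵥ v = maxEig M • v := by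
  have hne : {μ : ℝ | Module.End.HasEigenvalue (Matrix.toLin' M) μ}.Nonempty := by
    refine ⟨hM.eigenvalues 0, Module.End.hasEigenvalue_of_hasEigenvector
      (x := (hM.eigenvectorBasis 0).ofLp) ⟨Module.End.mem_eigenspace_iff.2 ?_, ?_⟩⟩
    · simpa using hM.mulVec_eigenvectorBasis 0
    · intro h
      exact hM.eigenvectorBasis.toBasis.ne_zero 0 (by ext i; simpa using congrFun h i)
  obtain ⟨v, hv⟩ := (hne.csSup_mem (finite_setOf_hasEigenvalue M)).exists_hasEigenvector
  exact ⟨v, hv.2, (Matrix.toLin'_apply M v).symm.trans hv.apply_eq_smul⟩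

lemma maxEig_smul_sub_posSemidef {m : ℕ} {M : Matrix (Fin m) (Fin m) ℝ}
    (hM : M.IsHermitian) : (maxEig M • (1 : Matrix (Fin m) (Fin m) ℝ) - M).PosSemidef := by
  have hA : (maxEig M • (1 : Matrix (Fin m) (Fin m) ℝ) - M).IsHermitian :=
    (Matrix.isHermitian_one.smul (IsSelfAdjoint.all _)).sub hM
  refine hA.posSemidef_iff_eigenvalues_nonneg.2 fun i => ?_
  have h := hA.mulVec_eigenvectorBasis i
  have hne : (hA.eigenvectorBasis i).ofLp ≠ 0 := fun h =>
    hA.eigenvectorBasis.toBasis.ne_zero i (by ext j; simpa using congrFun h j)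
  have := le_maxEig M (μ := maxEig M - hA.eigenvalues i) hne (by
    rw [sub_smul, ← h, Matrix.sub_mulVec, Matrix.smul_mulVec, Matrix.one_mulVec]
    abel)
  simpa using this

lemma dotProduct_mulVec_le_maxEig {m : ℕ} {M : Matrix (Fin m) (Fin m) ℝ}
    (hM : M.IsHermitian) (u : Fin m → ℝ) : u ⬝ᵥ M *ᵥ u ≤ maxEig M * (u ⬝ᵥ u) := by
  have := (maxEig_smul_sub_posSemidef hM).dotProduct_mulVec_nonneg u
  simp only [star_trivial, Matrix.sub_mulVec, Matrix.smul_mulVec, Matrix.one_mulVec,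
    dotProduct_sub, dotProduct_smul, smul_eq_mul] at this
  linarith

lemma mulVec_eq_of_maxEig_le {m : ℕ} {M : Matrix (Fin m) (Fin m) ℝ}
    (hM : M.IsHermitian) (u : Fin m → ℝ) (hu : maxEig M * (u ⬝ᵥ u) ≤ u ⬝ᵥ M *ᵥ u) :
    M *ᵥ u = maxEig M • u := by
  have hp := maxEig_smul_sub_posSemidef hM
  have h := (hp.dotProduct_mulVec_zero_iff u).1 (by
    have := dotProduct_mulVec_le_maxEig hM u
    simp only [star_trivial, Matrix.sub_mulVec, Matrix.smul_mulVec, Matrix.one_mulVec,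
      dotProduct_sub, dotProduct_smul, smul_eq_mul]
    linarith)
  rw [Matrix.sub_mulVec, Matrix.smul_mulVec, Matrix.one_mulVec, sub_eq_zero] at h
  exact h.symm

/-- A symmetric matrix with nonnegative off-diagonal entries has a nonnegative eigenvector
for its largest eigenvalue. -/
lemma exists_nonneg_eigenvector {m : ℕ} {M : Matrix (Fin (m + 1)) (Fin (m + 1)) ℝ}
    (hM : M.IsHermitian) (hoff : ∀ i j, i ≠ j → 0 ≤ M i j) :
    ∃ v ≠ 0, (∀ i, 0 ≤ v i) ∧ M *ᵥ v = maxEig M • v := by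
  obtain ⟨v, hv0, hv⟩ := exists_mulVec_eq_maxEig_smul hM
  refine ⟨fun i => |v i|, fun h => hv0 (funext fun i => abs_eq_zero.1 (congrFun h i)),
    fun i => abs_nonneg _, mulVec_eq_of_maxEig_le hM _ ?_⟩
  have h1 : (fun i => |v i|) ⬝ᵥ (fun i => |v i|) = v ⬝ᵥ v := by
    simp [dotProduct]
  have h2 : v ⬝ᵥ M *ᵥ v = maxEig M * (v ⬝ᵥ v) := by
    rw [hv, dotProduct_smul, smul_eq_mul]
  rw [h1, ← h2]
  simp only [dotProduct, mulVec, Finset.mul_sum]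
  refine Finset.sum_le_sum fun i _ => Finset.sum_le_sum fun j _ => ?_
  by_cases hij : i = j
  · subst hij
    refine le_of_eq ?_
    linear_combination -M i i * abs_mul_abs_self (v i)
  · have := hoff i j hij
    calc v i * (M i j * v j) = M i j * (v i * v j) := by ring
      _ ≤ M i j * (|v i| * |v j|) := by
          rw [← abs_mul]; exact mul_le_mul_of_nonneg_left (le_abs_self _) this
      _ = _ := by ring

lemma tridiag_isHermitian (k : ℕ) (d o : ℕ → ℝ) : (Tridiag k d o).IsHermitian := by
  ext i j
  simp only [Tridiag, Matrix.conjTranspose_apply, Matrix.of_apply, star_trivial]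
  split_ifs <;> first | omega | simp_all

lemma sum_tridiag_mul (k : ℕ) (d o K : ℕ → ℝ) (j : Fin (k + 1)) :
    ∑ i : Fin (k + 1), Tridiag k d o i j * K i
      = (if (j : ℕ) = 0 then 0 else o (j - 1) * K (j - 1)) + d j * K j
        + (if (j : ℕ) < k then o j * K (j + 1) else 0) := by
  have h : ∀ i : Fin (k + 1), Tridiag k d o i j * K i
      = (fun i : ℕ => (if i + 1 = (j : ℕ) then o i * K i else 0) + (if i = (j : ℕ) then d i * K i else 0)
        + (if i = (j : ℕ) + 1 then o j * K i else 0)) i := by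
    intro i
    simp only [Tridiag, Matrix.of_apply]
    split_ifs <;> first | omega | simp
  rw [Finset.sum_congr rfl fun i _ => h i, Fin.sum_univ_eq_sum_range
    (fun i : ℕ => (if i + 1 = (j : ℕ) then o i * K i else 0) + (if i = (j : ℕ) then d i * K i else 0)
        + (if i = (j : ℕ) + 1 then o j * K i else 0)),
    Finset.sum_add_distrib, Finset.sum_add_distrib]
  have hj := j.isLt
  congr 1
  · congr 1
    · obtain ⟨j, hj⟩ := j
      cases j with
      | zero => simp
      | succ j => simp at hj ⊢; omega
    · simp [hj]
  · simp

/-- The largest eigenvalue of the tridiagonal matrix whose last diagonal entry is lowered by `ε`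
lies between those of the matrix itself and of its leading principal submatrix, and has a
nonnegative eigenvector. -/
lemma exists_eigenvector_lowered (k : ℕ) (b a : ℕ → ℝ) (ha : ∀ i ≤ k, 0 ≤ a i) {ε : ℝ} (hε : 0 ≤ ε) :
    ∃ (θ : ℝ) (f : Fin (k + 2) → ℝ), maxEig (Tridiag k b a) ≤ θ ∧ θ ≤ maxEig (Tridiag (k + 1) b a) ∧
      f ≠ 0 ∧ (∀ i, 0 ≤ f i) ∧ ∀ (K : ℕ → ℝ) (z : ℝ),
        (∀ i ≤ k + 1, z * K i = (if i = 0 then 0 else a (i - 1) * K (i - 1)) + b i * K i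
          + a i * K (i + 1)) →
        (z - θ) * ∑ i : Fin (k + 2), f i * K i
          = f (Fin.last (k + 1)) * (ε * K (k + 1) + a (k + 1) * K (k + 2)) := by
  set d := Function.update b (k + 1) (b (k + 1) - ε) with hd
  set T := Tridiag (k + 1) d a with hT
  have hTh : T.IsHermitian := tridiag_isHermitian _ _ _
  obtain ⟨f, hf0, hf, hfT⟩ := exists_nonneg_eigenvector hTh (by
    intro i j hij
    have := Fin.val_ne_of_ne hij
    simp only [hT, Tridiag, Matrix.of_apply, if_neg this]
    split_ifs
    · exact ha _ (by omega)
    · exact ha _ (by omega)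
    · exact le_rfl)
  refine ⟨maxEig T, f, ?_, ?_, hf0, hf, ?_⟩
  · obtain ⟨h, hh0, hh⟩ := exists_mulVec_eq_maxEig_smul (tridiag_isHermitian k b a)
    have hpos : 0 < h ⬝ᵥ h := by
      have := Matrix.dotProduct_star_self_pos_iff.2 hh0
      simpa using this
    have hsub : ∀ i j : Fin (k + 1), T i.castSucc j.castSucc = Tridiag k b a i j := by
      intro i j
      have := i.isLt
      have hne : (i : ℕ) ≠ k + 1 := by omega
      simp [hT, Tridiag, hd, Function.update_of_ne hne]
    have h1 := dotProduct_mulVec_le_maxEig hTh (Fin.snoc h 0)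
    have h2 : (Fin.snoc h 0 : Fin (k + 2) → ℝ) ⬝ᵥ T *ᵥ (Fin.snoc h 0)
        = h ⬝ᵥ Tridiag k b a *ᵥ h := by
      simp [dotProduct, mulVec, Fin.sum_univ_castSucc (n := k + 1), hsub]
    have h3 : (Fin.snoc h 0 : Fin (k + 2) → ℝ) ⬝ᵥ (Fin.snoc h 0) = h ⬝ᵥ h := by
      simp [dotProduct, Fin.sum_univ_castSucc (n := k + 1)]
    rw [h2, h3, hh, dotProduct_smul, smul_eq_mul] at h1
    exact le_of_mul_le_mul_right h1 hpos
  · have hpos : 0 < f ⬝ᵥ f := by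
      have := Matrix.dotProduct_star_self_pos_iff.2 hf0
      simpa using this
    have hS : T = Tridiag (k + 1) b a
        - Matrix.diagonal (Pi.single (Fin.last (k + 1)) ε) := by
      ext i j
      have hi := i.isLt
      simp only [hT, hd, Tridiag, Matrix.of_apply, Matrix.sub_apply, Matrix.diagonal_apply,
        Pi.single_apply, Function.update_apply, Fin.ext_iff, Fin.val_last]
      split_ifs <;> simp_all
    have h1 := dotProduct_mulVec_le_maxEig (tridiag_isHermitian (k + 1) b a) f
    have h2 : f ⬝ᵥ T *ᵥ f = maxEig T * (f ⬝ᵥ f) := by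
      rw [hfT, dotProduct_smul, smul_eq_mul]
    have h3 : f ⬝ᵥ Matrix.diagonal (Pi.single (Fin.last (k + 1)) ε) *ᵥ f
        = ε * f (Fin.last (k + 1)) ^ 2 := by
      simp only [dotProduct, Matrix.mulVec_diagonal]
      rw [Finset.sum_eq_single (Fin.last (k + 1))]
      · simp; ring
      · intro i _ hi; simp [hi]
      · simp
    have h4 : f ⬝ᵥ T *ᵥ f = f ⬝ᵥ Tridiag (k + 1) b a *ᵥ f - ε * f (Fin.last (k + 1)) ^ 2 := by
      rw [← h3, ← dotProduct_sub, ← Matrix.sub_mulVec, ← hS]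
    have h5 : 0 ≤ ε * f (Fin.last (k + 1)) ^ 2 := by positivity
    exact le_of_mul_le_mul_right (by linarith) hpos
  · intro K z hK
    have h1 : ∑ i, (T *ᵥ f) i * K i = maxEig T * ∑ i, f i * K i := by
      rw [hfT, Finset.mul_sum]
      exact Finset.sum_congr rfl fun i _ => by simp [mul_assoc]
    have h2 : ∑ i : Fin (k + 2), (T *ᵥ f) i * K i
        = ∑ j : Fin (k + 2), f j * ∑ i : Fin (k + 2), T i j * K i := by
      simp only [mulVec, dotProduct, Finset.sum_mul, Finset.mul_sum]
      rw [Finset.sum_comm]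
      exact Finset.sum_congr rfl fun j _ => Finset.sum_congr rfl fun i _ => by ring
    have h3 : ∀ j : Fin (k + 2), ∑ i : Fin (k + 2), T i j * K i
        = z * K j - if j = Fin.last (k + 1) then ε * K (k + 1) + a (k + 1) * K (k + 2) else 0 := by
      intro j
      have hj := j.isLt
      rw [hT, sum_tridiag_mul, hK j (by omega)]
      by_cases hjk : j = Fin.last (k + 1)
      · subst hjk
        simp [hd]
        ring
      · have hne : (j : ℕ) ≠ k + 1 := fun h => hjk (Fin.ext h)
        have hlt : (j : ℕ) < k + 1 := by omega
        simp [hjk, hd, Function.update_of_ne hne, hlt]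
    have h4 : ∑ j : Fin (k + 2), f j * ∑ i : Fin (k + 2), T i j * K i
        = z * ∑ i, f i * K i
          - f (Fin.last (k + 1)) * (ε * K (k + 1) + a (k + 1) * K (k + 2)) := by
      simp only [h3, mul_sub, Finset.sum_sub_distrib, Finset.mul_sum]
      congr 1
      · exact Finset.sum_congr rfl fun j _ => by ring
      · simp
    linarith

/-- The spectral form of the linear programming bound, for a family of kernels satisfying a
three-term recurrence. -/
lemma card_mul_one_sub_maxEig_le {X : Type*} [DecidableEq X] (C : Finset X) (k : ℕ) (b a s : ℕ → ℝ)
    (K : ℕ → X → X → ℝ) (z : X → X → ℝ)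
    (ha : ∀ i ≤ k, 0 ≤ a i) (hak : 0 < a (k + 1)) (hs : ∀ i ≤ k + 2, 0 < s i)
    (hrec : ∀ x ∈ C, ∀ y ∈ C, ∀ i ≤ k + 1,
      z x y * K i x y = (if i = 0 then 0 else a (i - 1) * K (i - 1) x y) + b i * K i x y
          + a i * K (i + 1) x y)
    (hdiag : ∀ x ∈ C, ∀ i ≤ k + 2, K i x x = s i) (hz : ∀ x ∈ C, z x x = 1)
    (hpos : ∀ i ≤ k + 2, ∀ j ≤ k + 2, 0 ≤ ∑ x ∈ C, ∑ y ∈ C, K i x y * K j x y)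
    (hsq : (C.card : ℝ) ^ 2 ≤ ∑ x ∈ C, ∑ y ∈ C, K (k + 1) x y * K (k + 1) x y)
    (hoff : ∀ x ∈ C, ∀ y ∈ C, x ≠ y → z x y ≤ maxEig (Tridiag k b a))
    (hlt : maxEig (Tridiag (k + 1) b a) < 1) :
    C.card * (1 - maxEig (Tridiag (k + 1) b a)) ≤ 4 * a (k + 1) * s (k + 1) * s (k + 2) := by
  have hs1 := hs (k + 1) (by omega)
  have hs2 := hs (k + 2) le_rfl
  rcases C.eq_empty_or_nonempty with rfl | ⟨x₀, hx₀⟩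
  · simp; positivity
  set ε := a (k + 1) * s (k + 2) / s (k + 1) with hε
  have hεpos : 0 < ε := by positivity
  obtain ⟨θ, f, hθ1, hθ2, hf0, hf, hfK⟩ := exists_eigenvector_lowered k b a ha hεpos.le
  set φ : X → X → ℝ := fun x y => ∑ i : Fin (k + 2), f i * K i x y with hφ
  set φ₀ := ∑ i : Fin (k + 2), f i * s i with hφ₀
  set g := f (Fin.last (k + 1)) with hg
  have hF : ∀ x ∈ C, ∀ y ∈ C, (z x y - θ) * φ x y
      = g * (ε * K (k + 1) x y + a (k + 1) * K (k + 2) x y) := fun x hx y hy =>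
    hfK (fun i => K i x y) (z x y) (hrec x hx y hy)
  have hφd : ∀ x ∈ C, φ x x = φ₀ := fun x hx =>
    Finset.sum_congr rfl fun i _ => by rw [hdiag x hx i (by omega)]
  have hφ₀pos : 0 < φ₀ := by
    obtain ⟨i, hi⟩ := Function.ne_iff.1 hf0
    refine Finset.sum_pos' (fun i _ => mul_nonneg (hf i) (hs i (by omega)).le)
      ⟨i, Finset.mem_univ _, mul_pos (lt_of_le_of_ne (hf i) (Ne.symm hi)) (hs i (by omega))⟩
  have hεs : ε * s (k + 1) = a (k + 1) * s (k + 2) := by rw [hε]; field_simp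
  have h0 : (1 - θ) * φ₀ = g * (2 * (ε * s (k + 1))) := by
    have := hF x₀ hx₀ x₀ hx₀
    rw [hz x₀ hx₀, hφd x₀ hx₀, hdiag x₀ hx₀ _ (by omega), hdiag x₀ hx₀ _ le_rfl, ← hεs] at this
    linarith
  have hg0 : 0 < g := by
    have : 0 < g * (2 * (ε * s (k + 1))) := by
      rw [← h0]; exact mul_pos (by linarith) hφ₀pos
    exact pos_of_mul_pos_left this (by positivity)
  have hup : ∑ x ∈ C, ∑ y ∈ C, (z x y - θ) * φ x y * φ x y ≤ C.card * ((1 - θ) * φ₀ ^ 2) := by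
    rw [← nsmul_eq_mul]
    refine Finset.sum_le_card_nsmul _ _ _ fun x hx => ?_
    rw [← Finset.add_sum_erase _ _ hx, hz x hx, hφd x hx]
    have : ∑ y ∈ C.erase x, (z x y - θ) * φ x y * φ x y ≤ 0 := by
      refine Finset.sum_nonpos fun y hy => ?_
      have := hoff x hx y (Finset.mem_of_mem_erase hy) (Finset.ne_of_mem_erase hy).symm
      rw [mul_assoc]
      exact mul_nonpos_of_nonpos_of_nonneg (by linarith) (mul_self_nonneg _)
    linarith
  have hlow : g * ε * g * (C.card : ℝ) ^ 2 ≤ ∑ x ∈ C, ∑ y ∈ C, (z x y - θ) * φ x y * φ x y := by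
    have e : ∑ x ∈ C, ∑ y ∈ C, (z x y - θ) * φ x y * φ x y
        = ∑ i : Fin (k + 2), g * f i * (ε * (∑ x ∈ C, ∑ y ∈ C, K (k + 1) x y * K i x y)
          + a (k + 1) * ∑ x ∈ C, ∑ y ∈ C, K (k + 2) x y * K i x y) := by
      simp only [Finset.mul_sum, ← Finset.sum_add_distrib]
      symm
      rw [Finset.sum_comm]
      refine Finset.sum_congr rfl fun x hx => ?_
      rw [Finset.sum_comm]
      refine Finset.sum_congr rfl fun y hy => ?_
      rw [hF x hx y hy, hφ, Finset.mul_sum]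
      exact Finset.sum_congr rfl fun i _ => by ring
    have hnn : ∀ i : Fin (k + 2), 0 ≤ g * f i * (ε * (∑ x ∈ C, ∑ y ∈ C, K (k + 1) x y * K i x y)
          + a (k + 1) * ∑ x ∈ C, ∑ y ∈ C, K (k + 2) x y * K i x y) := fun i =>
      mul_nonneg (mul_nonneg hg0.le (hf i)) (add_nonneg
        (mul_nonneg hεpos.le (hpos _ (by omega) _ (by omega)))
        (mul_nonneg hak.le (hpos _ (by omega) _ (by omega))))
    rw [e]
    refine le_trans ?_ (Finset.single_le_sum (fun i _ => hnn i)
      (Finset.mem_univ (Fin.last (k + 1))))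
    have h2 := hpos (k + 2) le_rfl (k + 1) (by omega)
    simp only [Fin.val_last, ← hg]
    rw [mul_add]
    have h3 : 0 ≤ g * g * (a (k + 1) * ∑ x ∈ C, ∑ y ∈ C, K (k + 2) x y * K (k + 1) x y) := by
      positivity
    have h4 := mul_le_mul_of_nonneg_left hsq (show 0 ≤ g * g * ε by positivity)
    linarith
  have hcard : (0 : ℝ) < C.card := by exact_mod_cast Finset.card_pos.2 ⟨x₀, hx₀⟩
  have h5 : ε * g ^ 2 * C.card ≤ (1 - θ) * φ₀ ^ 2 := by
    refine le_of_mul_le_mul_left ?_ hcard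
    linarith
  have h6 : ε * g ^ 2 * (C.card * (1 - θ)) ≤ ε * g ^ 2 * (4 * ε * s (k + 1) ^ 2) := by
    have := mul_le_mul_of_nonneg_right h5 (show 0 ≤ 1 - θ by linarith)
    calc _ = ε * g ^ 2 * C.card * (1 - θ) := by ring
      _ ≤ _ := this
      _ = ((1 - θ) * φ₀) ^ 2 := by ring
      _ = _ := by rw [h0]; ring
  have h7 := le_of_mul_le_mul_left h6 (by positivity)
  have h8 : (C.card : ℝ) * (1 - maxEig (Tridiag (k + 1) b a)) ≤ C.card * (1 - θ) :=
    mul_le_mul_of_nonneg_left (by linarith) hcard.le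
  have h9 : 4 * ε * s (k + 1) ^ 2 = 4 * a (k + 1) * s (k + 1) * s (k + 2) := by
    linear_combination 4 * s (k + 1) * hεs
  linarith

end

section
open Finset

/-- The multiplicity of the `i`-th eigenspace of the Johnson scheme. -/
noncomputable def johnsonMult (n i : ℕ) : ℝ :=
  n.choose i * ((n : ℝ) - 2 * i + 1) / ((n : ℝ) - i + 1)

lemma johnsonMult_pos {n i : ℕ} (h : 2 * i ≤ n) : 0 < johnsonMult n i := by
  have h1 : (2 * i : ℝ) ≤ n := by exact_mod_cast h
  have h2 : (0 : ℝ) ≤ i := i.cast_nonneg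
  have h3 : (0 : ℝ) < n.choose i := by exact_mod_cast Nat.choose_pos (by omega)
  unfold johnsonMult
  have : (0 : ℝ) < n - 2 * i + 1 := by linarith
  have : (0 : ℝ) < n - i + 1 := by linarith
  positivity

lemma johnsonMult_succ {n i : ℕ} (h : 2 * i + 2 ≤ n) :
    ((i : ℝ) + 1) * ((n : ℝ) - 2 * i + 1) * johnsonMult n (i + 1)
      = ((n : ℝ) - i + 1) * ((n : ℝ) - 2 * i - 1) * johnsonMult n i := by
  have h1 : (2 * i + 2 : ℝ) ≤ n := by exact_mod_cast h
  have h2 : (0 : ℝ) ≤ i := i.cast_nonneg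
  have h3 : (n.choose (i + 1) : ℝ) * (i + 1) = n.choose i * ((n : ℝ) - i) := by
    have := Nat.choose_succ_right_eq n i
    rw [← Nat.cast_sub (by omega)]
    exact_mod_cast this
  have h4 : (n : ℝ) - i ≠ 0 := by linarith
  have h5 : (n : ℝ) - i + 1 ≠ 0 := by linarith
  unfold johnsonMult
  have e1 : (n : ℝ) - ((i + 1 : ℕ) : ℝ) + 1 = n - i := by push_cast; ring
  rw [e1]
  push_cast
  rw [mul_div_assoc', mul_div_assoc', div_eq_div_iff h4 h5]
  linear_combination ((n : ℝ) - 2 * i + 1) * ((n : ℝ) - 2 * (i + 1) + 1) * ((n : ℝ) - i + 1) * h3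

lemma sqrt_mul_sqrt_johnsonMult_succ {n i : ℕ} (h : 2 * i + 2 ≤ n) :
    √((((i : ℝ) + 1) * ((n : ℝ) - i + 1)) / (((n : ℝ) - 2 * i + 1) * ((n : ℝ) - 2 * i - 1)))
        * √(johnsonMult n (i + 1))
      = ((n : ℝ) - i + 1) / ((n : ℝ) - 2 * i + 1) * √(johnsonMult n i) := by
  have h1 : (2 * i + 2 : ℝ) ≤ n := by exact_mod_cast h
  have h2 : (0 : ℝ) ≤ i := i.cast_nonneg
  have p1 : (0 : ℝ) < n - i + 1 := by linarith
  have p2 : (0 : ℝ) < n - 2 * i + 1 := by linarith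
  have p3 : (0 : ℝ) < n - 2 * i - 1 := by linarith
  rw [← Real.sqrt_mul (by positivity), ← Real.sqrt_sq (show 0 ≤ ((n : ℝ) - i + 1) /
    ((n : ℝ) - 2 * i + 1) by positivity), ← Real.sqrt_mul (by positivity)]
  congr 1
  have := johnsonMult_succ h
  generalize (n : ℝ) - 2 * i + 1 = D at *
  generalize (n : ℝ) - 2 * i - 1 = E at *
  generalize (n : ℝ) - i + 1 = F at *
  have p4 := p1.ne'
  have p5 := p2.ne'
  have p6 := p3.ne'
  field_simp
  linear_combination this

lemma sqrt_mul_sqrt_johnsonMult {n i : ℕ} (h : 2 * i + 2 ≤ n) :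
    √((((i : ℝ) + 1) * ((n : ℝ) - i + 1)) / (((n : ℝ) - 2 * i + 1) * ((n : ℝ) - 2 * i - 1)))
        * √(johnsonMult n i)
      = ((i : ℝ) + 1) / ((n : ℝ) - 2 * i - 1) * √(johnsonMult n (i + 1)) := by
  have h1 : (2 * i + 2 : ℝ) ≤ n := by exact_mod_cast h
  have h2 : (0 : ℝ) ≤ i := i.cast_nonneg
  have p1 : (0 : ℝ) < n - i + 1 := by linarith
  have p2 : (0 : ℝ) < n - 2 * i + 1 := by linarith
  have p3 : (0 : ℝ) < n - 2 * i - 1 := by linarith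
  rw [← Real.sqrt_mul (by positivity), ← Real.sqrt_sq (show 0 ≤ ((i : ℝ) + 1) /
    ((n : ℝ) - 2 * i - 1) by positivity), ← Real.sqrt_mul (by positivity)]
  congr 1
  have := johnsonMult_succ h
  generalize (n : ℝ) - 2 * i + 1 = D at *
  generalize (n : ℝ) - 2 * i - 1 = E at *
  generalize (n : ℝ) - i + 1 = F at *
  have p4 := p1.ne'
  have p5 := p2.ne'
  have p6 := p3.ne'
  field_simp
  linear_combination -this

/-- Three-term recurrence of the Hahn polynomials normalized to have value `1` at `0`. -/
lemma normalized_hahn_recurrence {n w m : ℕ} (t : ℝ) (hm : m + 1 < w) (hwn : 2 * w ≤ n) :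
    (1 - n * t / (w * ((n : ℝ) - w)))
        * (hahn (m + 1) (w - t) t t (n - w - t) / fallProd w (n - w) (m + 1))
      = (n * ((w : ℝ) - m) * ((n : ℝ) - w - m) / (w * ((n : ℝ) - w) * ((n : ℝ) - 2 * m)))
          * (((m : ℝ) + 1) / ((n : ℝ) - 2 * m - 1))
          * (hahn m (w - t) t t (n - w - t) / fallProd w (n - w) m)
        + ((n : ℝ) - 2 * w) ^ 2 * (m + 1) * ((n : ℝ) - (m + 1) + 1)
            / (w * ((n : ℝ) - w) * ((n : ℝ) - 2 * (m + 1)) * ((n : ℝ) - 2 * (m + 1) + 2))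
          * (hahn (m + 1) (w - t) t t (n - w - t) / fallProd w (n - w) (m + 1))
        + (n * ((w : ℝ) - (m + 1)) * ((n : ℝ) - w - (m + 1))
            / (w * ((n : ℝ) - w) * ((n : ℝ) - 2 * (m + 1))))
          * (((n : ℝ) - (m + 1) + 1) / ((n : ℝ) - 2 * (m + 1) + 1))
          * (hahn (m + 2) (w - t) t t (n - w - t) / fallProd w (n - w) (m + 2)) := by
  have h1 : (m + 2 : ℝ) ≤ w := by exact_mod_cast hm
  have h2 : (2 * w : ℝ) ≤ n := by exact_mod_cast hwn
  have h3 : (0 : ℝ) ≤ m := m.cast_nonneg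
  have q0 : (w : ℝ) ≠ 0 := by linarith
  have q1 : (n : ℝ) - w ≠ 0 := by linarith
  have q2 : (n : ℝ) - 2 * m ≠ 0 := by linarith
  have q3 : (n : ℝ) - 2 * m - 1 ≠ 0 := by linarith
  have q4 : (n : ℝ) - 2 * (m + 1) ≠ 0 := by linarith
  have q5 : (n : ℝ) - 2 * (m + 1) + 1 ≠ 0 := by linarith
  have q6 : (n : ℝ) - 2 * (m + 1) + 2 ≠ 0 := by linarith
  have q7 : (w : ℝ) - (m + 1) ≠ 0 := by linarith
  have q8 : (n : ℝ) - w - (m + 1) ≠ 0 := by linarith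
  have q9 : (m : ℝ) + 1 ≠ 0 := by linarith
  have q10 : (m : ℝ) + 2 ≠ 0 := by linarith
  have q11 : (w : ℝ) - m ≠ 0 := by linarith
  have q12 : (n : ℝ) - w - m ≠ 0 := by linarith
  have e1 : fallProd w (n - w) (m + 1) ≠ 0 :=
    (fallProd_pos (by push_cast; linarith) (by push_cast; linarith)).ne'
  have e2 : fallProd w (n - w) (m + 2)
      = (w - (m + 1)) * (n - w - (m + 1)) * fallProd w (n - w) (m + 1) / (m + 2) := by
    have := fallProd_succ w (n - w) (m + 1)
    push_cast at this
    field_simp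
    linear_combination this
  have e3 : fallProd w (n - w) m
      = (m + 1) * fallProd w (n - w) (m + 1) / ((w - m) * (n - w - m)) := by
    have := fallProd_succ w (n - w) m
    field_simp
    linear_combination -this
  have H := hahn_recurrence m n w t q4 q5 q6
  have H' : (1 - n * t / (w * ((n : ℝ) - w))) * hahn (m + 1) (w - t) t t (n - w - t)
      = (w * (n - w) - n * t) * hahn (m + 1) (w - t) t t (n - w - t) / (w * (n - w)) := by
    field_simp
  have r1 : (n : ℝ) - 2 * m = n - 2 * (m + 1) + 2 := by ring
  have r2 : (n : ℝ) - 2 * m - 1 = n - 2 * (m + 1) + 1 := by ring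
  have r3 : (n : ℝ) - (m + 1) + 1 = n - m := by ring
  rw [← mul_div_assoc, H', H, e2, e3, r2, r1, r3]
  generalize hahn (m + 1) (w - t) t t (n - w - t) = X1
  generalize hahn (m + 2) (w - t) t t (n - w - t) = X2
  generalize hahn m (w - t) t t (n - w - t) = X0
  generalize fallProd (w : ℝ) (n - w) (m + 1) = E at *
  generalize (n : ℝ) - 2 * (m + 1) + 2 = D2 at *
  generalize (n : ℝ) - 2 * (m + 1) + 1 = D1 at *
  generalize (n : ℝ) - 2 * (m + 1) = D0 at *
  field_simp
  ring

variable {n : ℕ}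

lemma sum_bitVal (x : Fin n → Bool) : ∑ c, bitVal (x c) = wt x := by
  simp [bitVal, wt]

/-- The number of coordinates where `x` is `1` and `y` is `0`. -/
noncomputable def halfDist (x y : Fin n → Bool) : ℝ :=
  cellSum bitVal (fun b => 1 - bitVal b) Finset.univ x y

lemma halfDist_self (x : Fin n → Bool) : halfDist x x = 0 := by
  rw [halfDist, cellSum]
  refine Finset.sum_eq_zero fun c _ => ?_
  cases x c <;> simp [bitVal]

lemma cellSum_bitVal_bitVal (x y : Fin n → Bool) :
    cellSum bitVal bitVal Finset.univ x y = wt x - halfDist x y := by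
  rw [halfDist, cellSum, cellSum, ← sum_bitVal, ← Finset.sum_sub_distrib]
  exact Finset.sum_congr rfl fun c _ => by ring

lemma cellSum_compl_bitVal {x y : Fin n → Bool} (h : wt x = wt y) :
    cellSum (fun b => 1 - bitVal b) bitVal Finset.univ x y = halfDist x y := by
  have h1 := cellSum_bitVal_bitVal x y
  have h2 : cellSum (fun b => 1 - bitVal b) bitVal Finset.univ x y
      = wt y - cellSum bitVal bitVal Finset.univ x y := by
    rw [cellSum, cellSum, ← sum_bitVal, ← Finset.sum_sub_distrib]
    exact Finset.sum_congr rfl fun c _ => by ring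
  rw [h2, h1, h]; ring

lemma cellSum_compl_compl {x y : Fin n → Bool} (h : wt x = wt y) :
    cellSum (fun b => 1 - bitVal b) (fun b => 1 - bitVal b) Finset.univ x y
      = n - wt x - halfDist x y := by
  have h2 : cellSum (fun b => 1 - bitVal b) (fun b => 1 - bitVal b) Finset.univ x y
      = n - wt x - cellSum (fun b => 1 - bitVal b) bitVal Finset.univ x y := by
    have : (n : ℝ) = ∑ _c : Fin n, (1 : ℝ) := by simp
    rw [cellSum, cellSum, ← sum_bitVal, this, ← Finset.sum_sub_distrib, ← Finset.sum_sub_distrib]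
    exact Finset.sum_congr rfl fun c _ => by ring
  rw [h2, cellSum_compl_bitVal h]

lemma hammingDist_eq_two_mul_halfDist {x y : Fin n → Bool} (h : wt x = wt y) :
    (hammingDist x y : ℝ) = 2 * halfDist x y := by
  have h1 : (hammingDist x y : ℝ) = halfDist x y
      + cellSum (fun b => 1 - bitVal b) bitVal Finset.univ x y := by
    rw [halfDist, cellSum, cellSum, ← Finset.sum_add_distrib, hammingDist, Finset.card_filter]
    push_cast
    refine Finset.sum_congr rfl fun c _ => ?_
    cases x c <;> cases y c <;> simp [bitVal]
  rw [h1, cellSum_compl_bitVal h]; ring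

/-- The normalized zonal kernels of the Johnson space: on vectors of weight `w`, the `i`-th one
is the orthonormal Hahn polynomial of degree `i` in half the Hamming distance. -/
noncomputable def johnsonKernel (n w i : ℕ) : Matrix (Fin n → Bool) (Fin n → Bool) ℝ :=
  (√(johnsonMult n i) / (2 ^ i * i.factorial * fallProd w (n - w) i)) • pairKernel i Finset.univ

lemma johnsonKernel_eq {w i : ℕ} {x y : Fin n → Bool} (hx : wt x = w) (hy : wt y = w) :
    johnsonKernel n w i x y = √(johnsonMult n i)
      * (hahn i (w - halfDist x y) (halfDist x y) (halfDist x y) (n - w - halfDist x y)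
        / fallProd w (n - w) i) := by
  have hxy : wt x = wt y := hx.trans hy.symm
  have h : (i.factorial : ℝ) ≠ 0 := by positivity
  rw [johnsonKernel, Matrix.smul_apply, pairKernel_eq_hahn, cellSum_bitVal_bitVal,
    cellSum_compl_bitVal hxy, cellSum_compl_compl hxy, hx, smul_eq_mul]
  change _ * (_ * hahn i _ (halfDist x y) _ _) = _
  rw [div_mul_eq_mul_div, mul_div_assoc, mul_div_mul_left _ _ (by positivity)]

lemma johnsonKernel_self {w i : ℕ} {x : Fin n → Bool} (hx : wt x = w) (hi : i ≤ w)
    (hwn : 2 * w ≤ n) : johnsonKernel n w i x x = √(johnsonMult n i) := by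
  have h1 : (i : ℝ) ≤ w := by exact_mod_cast hi
  have h2 : (2 * w : ℝ) ≤ n := by exact_mod_cast hwn
  have h3 : (0 : ℝ) ≤ i := i.cast_nonneg
  have := (fallProd_pos (x := w) (y := n - w) h1 (by linarith)).ne'
  rw [johnsonKernel_eq hx hx, halfDist_self, sub_zero, sub_zero, hahn_diag, div_self this, mul_one]

lemma johnsonKernel_posSemidef {w i : ℕ} (hi : i ≤ w) (hwn : 2 * w ≤ n) :
    (johnsonKernel n w i).PosSemidef := by
  have h1 : (i : ℝ) ≤ w := by exact_mod_cast hi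
  have h2 : (2 * w : ℝ) ≤ n := by exact_mod_cast hwn
  have h3 : (0 : ℝ) ≤ i := i.cast_nonneg
  have := fallProd_pos (x := w) (y := n - w) h1 (by linarith)
  exact (pairKernel_posSemidef i _).smul (by positivity)

lemma johnsonKernel_zero (w : ℕ) (x y : Fin n → Bool) : johnsonKernel n w 0 x y = 1 := by
  have : (n : ℝ) + 1 ≠ 0 := by positivity
  simp [johnsonKernel, pairKernel_zero, fallProd, johnsonMult, this]

/-- The constant-weight vectors. -/
def johnsonSpace (n w : ℕ) : Finset (Fin n → Bool) := Finset.univ.filter fun y => wt y = w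

lemma wt_comp_perm (σ : Equiv.Perm (Fin n)) (y : Fin n → Bool) : wt (y ∘ σ) = wt y := by
  have : (wt (y ∘ σ) : ℝ) = wt y := by
    rw [← sum_bitVal, ← sum_bitVal]
    exact Equiv.sum_comp σ fun c => bitVal (y c)
  exact_mod_cast this

lemma sum_johnsonKernel_mul_eq_zero (w : ℕ) {i j : ℕ} (hij : i ≠ j) (x : Fin n → Bool) :
    ∑ y ∈ johnsonSpace n w, johnsonKernel n w i x y * johnsonKernel n w j x y = 0 := by
  have key : ∀ i j : ℕ, j < i → ∑ y ∈ johnsonSpace n w,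
      johnsonKernel n w i x y * johnsonKernel n w j x y = 0 := by
    intro i j hij
    have h := sum_pairKernel_mul_pairKernel_mul_eq_zero i j Finset.univ Finset.univ ∅ x x
      (fun y => if wt y = w then 1 else 0) (fun a _ b _ y => by rw [wt_comp_perm]) (by simpa)
    rw [johnsonSpace, Finset.sum_filter]
    simp only [johnsonKernel, Matrix.smul_apply, smul_eq_mul]
    refine Eq.trans (Finset.sum_congr rfl fun y _ => ?_) ((Finset.mul_sum _ _ _).symm.trans
      (mul_eq_zero_of_right ((√(johnsonMult n i) / (2 ^ i * i.factorial * fallProd w (n - w) i))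
        * (√(johnsonMult n j) / (2 ^ j * j.factorial * fallProd w (n - w) j))) h))
    split_ifs <;> ring
  rcases lt_or_gt_of_ne hij with h | h
  · rw [← key j i h]
    exact Finset.sum_congr rfl fun y _ => mul_comm _ _
  · exact key i j h

/-- A positive semidefinite matrix whose row sums over `J` equal `|J|` has
sum at least `|C|^2` over `C × C` for `C ⊆ J`. -/
lemma card_sq_le_sum_of_posSemidef {X : Type*} [Fintype X] [DecidableEq X] {A : Matrix X X ℝ}
    (hA : A.PosSemidef) {C J : Finset X} (hCJ : C ⊆ J)
    (hrow : ∀ x ∈ J, ∑ y ∈ J, A x y = J.card) :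
    (C.card : ℝ) ^ 2 ≤ ∑ x ∈ C, ∑ y ∈ C, A x y := by
  rcases C.eq_empty_or_nonempty with rfl | hC
  · simp
  have hJ : (J.card : ℝ) ≠ 0 := by
    exact_mod_cast (Finset.card_pos.2 (hC.mono hCJ)).ne'
  set c : ℝ := C.card / J.card with hc
  have h := hA.dotProduct_mulVec_nonneg
    (fun x => (if x ∈ C then 1 else 0) - c * (if x ∈ J then 1 else 0))
  have symm : ∀ x y, A x y = A y x := fun x y => by
    simpa using hA.isHermitian.apply y x
  have e : ∀ P Q : Finset X, ∑ x, ∑ y, (if x ∈ P then (1 : ℝ) else 0) * A x y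
      * (if y ∈ Q then 1 else 0) = ∑ x ∈ P, ∑ y ∈ Q, A x y := by
    intro P Q
    simp [ite_mul, Finset.sum_ite_mem]
  have hCJs : ∑ x ∈ C, ∑ y ∈ J, A x y = C.card * J.card := by
    rw [Finset.sum_congr rfl fun x hx => hrow x (hCJ hx)]; simp
  have hJCs : ∑ x ∈ J, ∑ y ∈ C, A x y = C.card * J.card := by
    refine Eq.trans Finset.sum_comm (Eq.trans ?_ hCJs)
    exact Finset.sum_congr rfl fun x _ => Finset.sum_congr rfl fun y _ => symm _ _
  have hJJs : ∑ x ∈ J, ∑ y ∈ J, A x y = J.card * J.card := by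
    rw [Finset.sum_congr rfl fun x hx => hrow x hx]; simp
  have hexp : ∑ x ∈ C, ∑ y ∈ C, A x y - c * (C.card * J.card) - c * (C.card * J.card)
      + c ^ 2 * (J.card * J.card) = star (fun x => (if x ∈ C then 1 else 0)
        - c * (if x ∈ J then 1 else 0)) ⬝ᵥ (Matrix.mulVec A
          (fun x => (if x ∈ C then 1 else 0) - c * (if x ∈ J then 1 else 0))) := by
    rw [← hJJs]
    nth_rw 1 [← hCJs]
    rw [← hJCs]
    simp only [← e, Finset.mul_sum, ← Finset.sum_sub_distrib, ← Finset.sum_add_distrib,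
      star_trivial, dotProduct, Matrix.mulVec]
    exact Finset.sum_congr rfl fun x _ => Finset.sum_congr rfl fun y _ => by ring
  rw [← hexp] at h
  have h1 : c * J.card = C.card := by rw [hc]; field_simp
  have h2 : c * (C.card * J.card) = (C.card : ℝ) ^ 2 := by rw [← h1]; ring
  have h3 : c ^ 2 * (J.card * J.card) = (C.card : ℝ) ^ 2 := by rw [← h1]; ring
  linarith

lemma sum_sum_mul_nonneg_of_posSemidef {X : Type*} [Fintype X] [DecidableEq X]
    {A B : Matrix X X ℝ} (hA : A.PosSemidef) (hB : B.PosSemidef) (C : Finset X) :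
    0 ≤ ∑ x ∈ C, ∑ y ∈ C, A x y * B x y := by
  have h := (hA.hadamard hB).dotProduct_mulVec_nonneg (fun x => if x ∈ C then 1 else 0)
  simpa [dotProduct, Matrix.mulVec] using h

end

section
variable {n w : ℕ}

/-- Off-diagonal recurrence coefficients of the orthonormal Hahn polynomials. -/
noncomputable def hahnOffDiag (n w i : ℕ) : ℝ :=
  ((n : ℝ) * ((w : ℝ) - i) * ((n : ℝ) - w - i)
      / ((w : ℝ) * ((n : ℝ) - w) * ((n : ℝ) - 2 * i)))
    * Real.sqrt ((((i : ℝ) + 1) * ((n : ℝ) - i + 1))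
      / (((n : ℝ) - 2 * i + 1) * ((n : ℝ) - 2 * i - 1)))

/-- Diagonal recurrence coefficients of the orthonormal Hahn polynomials. -/
noncomputable def hahnOnDiag (n w i : ℕ) : ℝ :=
  ((n : ℝ) - 2 * w) ^ 2 * (i : ℝ) * ((n : ℝ) - i + 1)
    / ((w : ℝ) * ((n : ℝ) - w) * ((n : ℝ) - 2 * i) * ((n : ℝ) - 2 * i + 2))

lemma hahnOffDiag_pos {i : ℕ} (hi : i < w) (hwn : 2 * w ≤ n) : 0 < hahnOffDiag n w i := by
  have h1 : (i + 1 : ℝ) ≤ w := by exact_mod_cast hi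
  have h2 : (2 * w : ℝ) ≤ n := by exact_mod_cast hwn
  have h3 : (0 : ℝ) ≤ i := i.cast_nonneg
  have p0 : (0 : ℝ) < n := by linarith
  have p1 : (0 : ℝ) < w := by linarith
  have p2 : (0 : ℝ) < (w : ℝ) - i := by linarith
  have p3 : (0 : ℝ) < (n : ℝ) - w - i := by linarith
  have p4 : (0 : ℝ) < (n : ℝ) - w := by linarith
  have p5 : (0 : ℝ) < (n : ℝ) - 2 * i := by linarith
  have p6 : (0 : ℝ) < (n : ℝ) - i + 1 := by linarith
  have p7 : (0 : ℝ) < (n : ℝ) - 2 * i + 1 := by linarith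
  have p8 : (0 : ℝ) < (n : ℝ) - 2 * i - 1 := by linarith
  unfold hahnOffDiag
  positivity

lemma hahnOffDiag_mul_sqrt_johnsonMult_succ {i : ℕ} (h : 2 * i + 2 ≤ n) :
    hahnOffDiag n w i * √(johnsonMult n (i + 1))
      = (n : ℝ) * ((w : ℝ) - i) * ((n : ℝ) - w - i)
          / ((w : ℝ) * ((n : ℝ) - w) * ((n : ℝ) - 2 * i))
        * (((n : ℝ) - i + 1) / ((n : ℝ) - 2 * i + 1)) * √(johnsonMult n i) := by
  rw [hahnOffDiag, mul_assoc, sqrt_mul_sqrt_johnsonMult_succ h, ← mul_assoc]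

lemma hahnOffDiag_mul_sqrt_johnsonMult {i : ℕ} (h : 2 * i + 2 ≤ n) :
    hahnOffDiag n w i * √(johnsonMult n i)
      = (n : ℝ) * ((w : ℝ) - i) * ((n : ℝ) - w - i)
          / ((w : ℝ) * ((n : ℝ) - w) * ((n : ℝ) - 2 * i))
        * (((i : ℝ) + 1) / ((n : ℝ) - 2 * i - 1)) * √(johnsonMult n (i + 1)) := by
  rw [hahnOffDiag, mul_assoc, sqrt_mul_sqrt_johnsonMult h, ← mul_assoc]

lemma johnsonMult_zero (n : ℕ) : johnsonMult n 0 = 1 := by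
  have : (n : ℝ) + 1 ≠ 0 := by positivity
  simp [johnsonMult, this]

/-- The linear orthonormal Hahn polynomial, up to scaling, as a function of half the distance. -/
noncomputable def zonalLinear (n w : ℕ) (x y : Fin n → Bool) : ℝ :=
  1 - n * halfDist x y / (w * ((n : ℝ) - w))

lemma zonalLinear_mul_johnsonKernel {i : ℕ} (hi : i < w) (hwn : 2 * w ≤ n) {x y : Fin n → Bool}
    (hx : wt x = w) (hy : wt y = w) :
    zonalLinear n w x y * johnsonKernel n w i x y
      = (if i = 0 then 0 else hahnOffDiag n w (i - 1) * johnsonKernel n w (i - 1) x y)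
        + hahnOnDiag n w i * johnsonKernel n w i x y
        + hahnOffDiag n w i * johnsonKernel n w (i + 1) x y := by
  rcases i with - | m
  · have h1 : (1 : ℝ) ≤ w := by exact_mod_cast hi
    have h2 : (2 * w : ℝ) ≤ n := by exact_mod_cast hwn
    have q0 : (w : ℝ) ≠ 0 := by linarith
    have q1 : (n : ℝ) - w ≠ 0 := by linarith
    have q2 : (n : ℝ) ≠ 0 := by linarith
    have q3 : (n : ℝ) + 1 ≠ 0 := by linarith
    have e := hahnOffDiag_mul_sqrt_johnsonMult_succ (n := n) (w := w) (i := 0) (by omega)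
    have f := succ_mul_hahn_succ' 0 (w - halfDist x y) (halfDist x y) (halfDist x y)
      (n - w - halfDist x y)
    have g : fallProd (w : ℝ) (n - w) 1 = w * (n - w) := by simp [fallProd]
    simp only [hahn_zero, Nat.cast_zero, zero_add, one_mul, mul_one] at f
    rw [johnsonKernel_eq (i := 0 + 1) hx hy, ← mul_assoc, e, johnsonKernel_zero, zero_add, f, g,
      johnsonMult_zero, Real.sqrt_one, zonalLinear, hahnOnDiag]
    simp only [if_true, Nat.cast_zero, sub_zero, mul_zero]
    field_simp
    ring
  · have a1 := hahnOffDiag_mul_sqrt_johnsonMult (n := n) (w := w) (i := m) (by omega)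
    have a2 := hahnOffDiag_mul_sqrt_johnsonMult_succ (n := n) (w := w) (i := m + 1) (by omega)
    have H := normalized_hahn_recurrence (halfDist x y) hi hwn
    simp only [Nat.add_eq_zero_iff, one_ne_zero, and_false, if_false, Nat.add_sub_cancel]
    rw [johnsonKernel_eq hx hy, johnsonKernel_eq hx hy, johnsonKernel_eq hx hy,
      ← mul_assoc (hahnOffDiag n w m), a1, ← mul_assoc (hahnOffDiag n w (m + 1)), a2, zonalLinear,
      hahnOnDiag]
    push_cast
    linear_combination √(johnsonMult n (m + 1)) * H

lemma sum_johnsonKernel_mul_self {i : ℕ} (hi : i < w) (hwn : 2 * w ≤ n) {x : Fin n → Bool}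
    (hx : wt x = w) :
    ∑ y ∈ johnsonSpace n w, johnsonKernel n w i x y * johnsonKernel n w i x y
      = (johnsonSpace n w).card := by
  induction i with
  | zero => simp [johnsonKernel_zero]
  | succ i ih =>
    have hpos := hahnOffDiag_pos (n := n) (i := i) (w := w) (by omega) hwn
    have orth := fun i j (h : i ≠ j) => sum_johnsonKernel_mul_eq_zero w h x
    have mem : ∀ y ∈ johnsonSpace n w, wt y = w := fun y hy => (Finset.mem_filter.1 hy).2
    have e1 : ∑ y ∈ johnsonSpace n w, zonalLinear n w x y * johnsonKernel n w i x y
        * johnsonKernel n w (i + 1) x y = hahnOffDiag n w i * ∑ y ∈ johnsonSpace n w,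
          johnsonKernel n w (i + 1) x y * johnsonKernel n w (i + 1) x y := by
      rw [Finset.sum_congr rfl fun y hy => by
        rw [zonalLinear_mul_johnsonKernel (i := i) (by omega) hwn hx (mem y hy)]]
      simp only [add_mul, Finset.sum_add_distrib, mul_assoc, ← Finset.mul_sum,
        orth i (i + 1) (by omega)]
      rcases i with - | j
      · simp
      · simp [mul_assoc, ← Finset.mul_sum, orth j (j + 1 + 1) (by omega)]
    have e2 : ∑ y ∈ johnsonSpace n w, zonalLinear n w x y * johnsonKernel n w (i + 1) x y
        * johnsonKernel n w i x y = hahnOffDiag n w i * ∑ y ∈ johnsonSpace n w,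
          johnsonKernel n w i x y * johnsonKernel n w i x y := by
      rw [Finset.sum_congr rfl fun y hy => by
        rw [zonalLinear_mul_johnsonKernel hi hwn hx (mem y hy)]]
      simp [add_mul, Finset.sum_add_distrib, mul_assoc, ← Finset.mul_sum,
        orth (i + 1) i (by omega), orth (i + 1 + 1) i (by omega)]
    rw [← ih (by omega)]
    refine mul_left_cancel₀ hpos.ne' (e1.symm.trans (Eq.trans ?_ e2))
    exact Finset.sum_congr rfl fun y _ => by ring

end

/-- Theorem 3: the spectral bound for binary constant-weight codes in the Johnson
space `J^{n,w}`. -/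
theorem johnson_code_spectral_bound (n w d k : ℕ)
    (hd : 0 < d) (hk : 1 ≤ k) (hkw : k < w) (hwn : 2 * w ≤ n) (hkn : 2 * k < n)
    (aH bH : ℕ → ℝ)
    (haH : aH = fun i : ℕ => ((n : ℝ) * ((w : ℝ) - i) * ((n : ℝ) - w - i)
        / ((w : ℝ) * ((n : ℝ) - w) * ((n : ℝ) - 2 * i)))
      * Real.sqrt ((((i : ℝ) + 1) * ((n : ℝ) - i + 1))
        / (((n : ℝ) - 2 * i + 1) * ((n : ℝ) - 2 * i - 1))))
    (hbH : bH = fun i : ℕ => ((n : ℝ) - 2 * w) ^ 2 * (i : ℝ) * ((n : ℝ) - i + 1)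
      / ((w : ℝ) * ((n : ℝ) - w) * ((n : ℝ) - 2 * i) * ((n : ℝ) - 2 * i + 2)))
    (hcond1 : 1 - (n : ℝ) * d / ((w : ℝ) * ((n : ℝ) - w)) ≤ maxEig (Tridiag (k - 1) bH aH))
    (hcond2 : maxEig (Tridiag k bH aH) < 1)
    (C : Finset (Fin n → Bool))
    (hwt : ∀ x ∈ C, wt x = w)
    (hdist : ∀ x ∈ C, ∀ y ∈ C, x ≠ y → 2 * d ≤ hammingDist x y) :
    (C.card : ℝ) ≤ 4 * (n : ℝ) * ((w : ℝ) - k) * ((n : ℝ) - w - k) * (Nat.choose n k)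
      / ((1 - maxEig (Tridiag k bH aH)) * (w : ℝ) * ((n : ℝ) - w) * ((n : ℝ) - 2 * k)) := by
  obtain ⟨k, rfl⟩ : ∃ l, k = l + 1 := ⟨k - 1, by omega⟩
  obtain rfl : aH = hahnOffDiag n w := haH
  obtain rfl : bH = hahnOnDiag n w := hbH
  rw [Nat.add_sub_cancel] at hcond1
  have hw : (0 : ℝ) < w := by exact_mod_cast (by omega : 0 < w)
  have hwn' : (2 * w : ℝ) ≤ n := by exact_mod_cast hwn
  have hkw' : ((k + 1 : ℕ) : ℝ) < w := by exact_mod_cast hkw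
  have hkn' : (2 * ((k + 1 : ℕ) : ℝ)) < n := by exact_mod_cast hkn
  have hnw : (0 : ℝ) < n - w := by linarith
  have hn0 : (0 : ℝ) < n := by linarith
  have hbound := card_mul_one_sub_maxEig_le C k (hahnOnDiag n w) (hahnOffDiag n w)
    (fun i => √(johnsonMult n i)) (fun i => johnsonKernel n w i) (zonalLinear n w)
    (fun i hi => (hahnOffDiag_pos (by omega) hwn).le) (hahnOffDiag_pos hkw hwn)
    (fun i hi => Real.sqrt_pos.2 (johnsonMult_pos (by omega)))
    (fun x hx y hy i hi => zonalLinear_mul_johnsonKernel (by omega) hwn (hwt x hx) (hwt y hy))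
    (fun x hx i hi => johnsonKernel_self (hwt x hx) (by omega) hwn)
    (fun x _ => by simp [zonalLinear, halfDist_self])
    (fun i hi j hj => sum_sum_mul_nonneg_of_posSemidef
      (johnsonKernel_posSemidef (by omega) hwn) (johnsonKernel_posSemidef (by omega) hwn) C)
    ?_ ?_ hcond2
  · have hs := hahnOffDiag_mul_sqrt_johnsonMult_succ (n := n) (w := w) (i := k + 1) (by omega)
    have hsq := Real.mul_self_sqrt (johnsonMult_pos (n := n) (i := k + 1) (by omega)).le
    have hρ : 0 < 1 - maxEig (Tridiag (k + 1) (hahnOnDiag n w) (hahnOffDiag n w)) := by linarith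
    have hn2k : 0 < (n : ℝ) - 2 * (k + 1 : ℕ) := by linarith
    have hn2k1 : (n : ℝ) - 2 * (k + 1 : ℕ) + 1 ≠ 0 := by linarith
    have hnk1 : (n : ℝ) - (k + 1 : ℕ) + 1 ≠ 0 := by linarith
    rw [le_div_iff₀ (by positivity)]
    have hval : 4 * hahnOffDiag n w (k + 1) * √(johnsonMult n (k + 1)) * √(johnsonMult n (k + 2))
        = 4 * (n : ℝ) * ((w : ℝ) - (k + 1 : ℕ)) * ((n : ℝ) - w - (k + 1 : ℕ))
          * (Nat.choose n (k + 1)) / ((w : ℝ) * ((n : ℝ) - w) * ((n : ℝ) - 2 * (k + 1 : ℕ))) := by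
      rw [show 4 * hahnOffDiag n w (k + 1) * √(johnsonMult n (k + 1)) * √(johnsonMult n (k + 2))
        = 4 * (hahnOffDiag n w (k + 1) * √(johnsonMult n (k + 1 + 1)))
          * √(johnsonMult n (k + 1)) by ring, hs, mul_assoc, mul_assoc, hsq, johnsonMult]
      generalize ((k + 1 : ℕ) : ℝ) = κ at *
      have := hn2k.ne'
      generalize (n : ℝ) - 2 * κ + 1 = D at *
      generalize (n : ℝ) - κ + 1 = E at *
      field_simp
    rw [hval, le_div_iff₀ (by positivity)] at hbound
    linarith
  · have h := card_sq_le_sum_of_posSemidef (C := C) (J := johnsonSpace n w)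
      ((johnsonKernel_posSemidef (n := n) hkw.le hwn).hadamard (johnsonKernel_posSemidef hkw.le hwn))
      (fun x hx => Finset.mem_filter.2 ⟨Finset.mem_univ x, hwt x hx⟩)
      (fun x hx => sum_johnsonKernel_mul_self hkw hwn (Finset.mem_filter.1 hx).2)
    exact h
  · intro x hx y hy hxy
    refine le_trans ?_ hcond1
    have h1 : (2 * d : ℝ) ≤ hammingDist x y := by exact_mod_cast hdist x hx y hy hxy
    rw [hammingDist_eq_two_mul_halfDist ((hwt x hx).trans (hwt y hy).symm)] at h1
    rw [zonalLinear]
    gcongr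
    linarith
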